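/- Let R be a commutative clean ring, n ≥ 2, and h ∈ R[t] a monic polynomial of degree n. The following are equivalent: (1) every matrix A ∈ Mₙ(R) whose characteristic polynomial equals h is strongly clean in Mₙ(R); (2) the companion matrix C_h of h is strongly clean in Mₙ(R); (3) h has a gSRC-factorization in R[t]. -/

import Mathlib

/-- An element of a ring is *strongly clean* if it is the sum of an idempotent and a unit
that commute with each other. -/
def IsStronglyClean {S : Type*} [Ring S] (a : S) : Prop :=
  ∃ e u : S, IsIdempotentElem e ∧ IsUnit u ∧ a = e + u ∧ e * u = u * e

/-- An SR-factorization of a monic polynomial `f` is a factorization `f = f₀ * f₁` into monic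
polynomials with `f₀(0)` and `f₁(1)` units. -/
def HasSRFactorization {R : Type*} [CommRing R] (f : Polynomial R) : Prop :=
  ∃ f₀ f₁ : Polynomial R, f₀.Monic ∧ f₁.Monic ∧ f = f₀ * f₁ ∧
    IsUnit (f₀.eval 0) ∧ IsUnit (f₁.eval 1)

/-- An SRC-factorization is an SR-factorization `f = f₀ * f₁` in which moreover the ideal
`(f₀, f₁)` is all of `R[t]`, i.e. `f₀ * u + f₁ * v = 1` for some `u, v`. -/
def HasSRCFactorization {R : Type*} [CommRing R] (f : Polynomial R) : Prop :=
  ∃ f₀ f₁ : Polynomial R, f₀.Monic ∧ f₁.Monic ∧ f = f₀ * f₁ ∧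
    IsUnit (f₀.eval 0) ∧ IsUnit (f₁.eval 1) ∧ ∃ u v : Polynomial R, f₀ * u + f₁ * v = 1

/-- A complete orthogonal set of idempotents: finitely many idempotents, pairwise orthogonal,
summing to `1`. -/
def IsCompleteOrthogonalIdempotents {R : Type*} [CommRing R] {k : ℕ} (e : Fin k → R) : Prop :=
  (∀ i, IsIdempotentElem (e i)) ∧ (∀ i j, i ≠ j → e i * e j = 0) ∧ ∑ i, e i = 1

/-- A monic `h ∈ R[t]` has a gSRC-factorization if there is a complete orthogonal set of
idempotents `e₁, …, e_k` such that the image of `h` in `(R/(1-eᵢ))[t]` has an SRC-factorization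
for each `i`. -/
def HasGSRCFactorization {R : Type*} [CommRing R] (h : Polynomial R) : Prop :=
  ∃ (k : ℕ) (e : Fin k → R), IsCompleteOrthogonalIdempotents e ∧
    ∀ i, HasSRCFactorization (h.map (Ideal.Quotient.mk (Ideal.span {1 - e i})))

/-- The companion matrix of a (monic, degree `n`) polynomial: ones on the subdiagonal and the
negatives of the coefficients in the last column. -/
def companionMatrix {R : Type*} [CommRing R] (n : ℕ) (h : Polynomial R) :
    Matrix (Fin n) (Fin n) R :=
  Matrix.of fun i j => if (i : ℕ) = (j : ℕ) + 1 then 1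
    else if (j : ℕ) = n - 1 then -h.coeff (i : ℕ) else 0

/-- A ring is *clean* if every element is the sum of an idempotent and a unit. -/
def IsCleanRing (R : Type*) [Ring R] : Prop :=
  ∀ a : R, ∃ e u : R, IsIdempotentElem e ∧ IsUnit u ∧ a = e + u

section AffineDeterminant

open Polynomial Matrix

variable {R S : Type*} [CommRing R] [CommRing S] [Algebra R S]
variable {ι : Type*} [Fintype ι] [DecidableEq ι] (b : Module.Basis ι R S)

/-- Multiplication by elements of `S`, written as matrices over an `R`-algebra `T`. -/
noncomputable def mulMatrix (T : Type*) [CommRing T] [Algebra R T] : S →+* Matrix ι ι T :=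
  (algebraMap R T).mapMatrix.comp (Algebra.leftMulMatrix b).toRingHom

/-- The ring homomorphism `S[X] → Mₙ(T)` which extends `mulMatrix` and sends `X` to the scalar
matrix `τ`. -/
noncomputable def polyMulMatrix {T : Type*} [CommRing T] [Algebra R T] (τ : T) :
    S[X] →+* Matrix ι ι T :=
  eval₂RingHom' (mulMatrix b T) (algebraMap T (Matrix ι ι T) τ)
    fun _ => (Algebra.commutes _ _).symm

/-- The norm of a polynomial over `S`, evaluated at an element `τ` of an `R`-algebra. -/
noncomputable def polyNorm {T : Type*} [CommRing T] [Algebra R T] (τ : T) (q : S[X]) : T :=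
  (polyMulMatrix b τ q).det

@[simp] lemma polyMulMatrix_C {T : Type*} [CommRing T] [Algebra R T] (τ : T) (s : S) :
    polyMulMatrix b τ (C s) = mulMatrix b T s :=
  eval₂_C _ _

@[simp] lemma polyMulMatrix_X {T : Type*} [CommRing T] [Algebra R T] (τ : T) :
    polyMulMatrix b τ (X : S[X]) = algebraMap T (Matrix ι ι T) τ :=
  eval₂_X _ _

lemma polyNorm_mul {T : Type*} [CommRing T] [Algebra R T] (τ : T) (q q' : S[X]) :
    polyNorm b τ (q * q') = polyNorm b τ q * polyNorm b τ q' := by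
  simp [polyNorm]

lemma map_polyNorm {T T' : Type*} [CommRing T] [Algebra R T] [CommRing T'] [Algebra R T']
    (f : T →ₐ[R] T') (τ : T) (q : S[X]) :
    f (polyNorm b τ q) = polyNorm b (f τ) q := by
  have key : f.toRingHom.mapMatrix.comp (polyMulMatrix b τ) = polyMulMatrix b (f τ) := by
    apply Polynomial.ringHom_ext
    · intro s
      ext i j
      simp [mulMatrix]
    · ext i j
      simp [Matrix.algebraMap_matrix_apply, apply_ite f]
  rw [polyNorm, polyNorm, ← key]
  exact f.toRingHom.map_det _

lemma isUnit_eval_polyNorm (r : R) (q : S[X]) (hq : IsUnit (q.eval (algebraMap R S r))) :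
    IsUnit ((polyNorm b (X : R[X]) q).eval r) := by
  have h1 : (polyNorm b (X : R[X]) q).eval r = polyNorm b r q := by
    have := map_polyNorm b (aeval r : R[X] →ₐ[R] R) X q
    simpa [coe_aeval_eq_eval] using this
  have key : polyMulMatrix b r =
      (Algebra.leftMulMatrix b).toRingHom.comp (evalRingHom (algebraMap R S r)) := by
    apply Polynomial.ringHom_ext
    · intro s
      simp [mulMatrix]
    · simp
  rw [h1, polyNorm, key]
  exact (Matrix.isUnit_iff_isUnit_det _).1 (hq.map (Algebra.leftMulMatrix b).toRingHom)

lemma polyNorm_X_sub_C (y : S) :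
    polyNorm b (X : R[X]) (X - C y) = (Algebra.leftMulMatrix b y).charpoly := by
  simp only [polyNorm, map_sub, polyMulMatrix_X, polyMulMatrix_C, Matrix.charpoly, charmatrix]
  rfl

/-- The rank polynomial of an idempotent of `S` acting on the free `R`-module `S`. -/
noncomputable def rankPoly (e : S) : R[X] := polyNorm b (X : R[X]) (C e * X + C (1 - e))

/-- For an idempotent `e` of `S`, the characteristic polynomial of multiplication by `x`
on the direct summand `e S`. -/
noncomputable def cornerCharpoly (x e : S) : R[X] :=
  polyNorm b (X : R[X]) (C e * X + C (1 - e - x * e))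

lemma polyNorm_mul_point {T : Type*} [CommRing T] [Algebra R T] {e : S}
    (he : IsIdempotentElem e) (σ τ : T) :
    polyNorm b (σ * τ) (C e * X + C (1 - e)) =
      polyNorm b σ (C e * X + C (1 - e)) * polyNorm b τ (C e * X + C (1 - e)) := by
  have hE : mulMatrix b T e * mulMatrix b T e = mulMatrix b T e := by rw [← map_mul, he.eq]
  simp only [polyNorm, ← det_mul]
  congr 1
  simp only [map_add, map_mul, map_sub, map_one, polyMulMatrix_C, polyMulMatrix_X,
    Algebra.algebraMap_eq_smul_one, Algebra.mul_smul_comm, mul_one, mul_add, add_mul, mul_sub,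
    sub_mul, Algebra.smul_mul_assoc, one_mul, hE]
  module

lemma rankPoly_coeff_mul_coeff {e : S} (he : IsIdempotentElem e) (i j : ℕ) :
    (rankPoly b e).coeff i * (rankPoly b e).coeff j =
      if i = j then (rankPoly b e).coeff j else 0 := by
  have h1 (τ : R[X][X]) : polyNorm b τ (C e * X + C (1 - e)) = aeval τ (rankPoly b e) := by
    rw [rankPoly, map_polyNorm, aeval_X]
  have h2 := polyNorm_mul_point b he (C (X : R[X])) (X : R[X][X])
  simp only [h1] at h2
  have h3 : aeval (C (X : R[X]) * (X : R[X][X])) (rankPoly b e) =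
      ((rankPoly b e).map C).comp (C X * X) := by
    rw [Polynomial.comp, eval₂_map, aeval_def]
    rfl
  have h4 : aeval (C (X : R[X])) (rankPoly b e) = C (rankPoly b e) := by
    rw [← Polynomial.algebraMap_eq, aeval_algebraMap_apply, aeval_X_left_apply]
  have h5 : aeval (X : R[X][X]) (rankPoly b e) = (rankPoly b e).map C := by
    rw [aeval_def, Polynomial.map, ← Polynomial.algebraMap_eq]
    rfl
  rw [h3, h4, h5] at h2
  have h6 := congrArg (fun q => (q.coeff j).coeff i) h2
  simpa [coeff_X_pow, coeff_C_mul, comp_C_mul_X_coeff, coeff_mul_C] using h6.symm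

lemma rankPoly_eval_one (e : S) : (rankPoly b e).eval 1 = 1 := by
  have := map_polyNorm b (aeval (1 : R) : R[X] →ₐ[R] R) X (C e * X + C (1 - e))
  simp only [coe_aeval_eq_eval, eval_X] at this
  rw [rankPoly, this]
  simp [polyNorm]

lemma monic_polyNorm_X_sub_C (y : S) : (polyNorm b (X : R[X]) (X - C y)).Monic := by
  rw [polyNorm_X_sub_C]
  exact charpoly_monic _

lemma monic_rankPoly_mul_rankPoly {e : S} (he : IsIdempotentElem e) :
    (rankPoly b (1 - e) * rankPoly b e).Monic := by
  rw [rankPoly, rankPoly, ← polyNorm_mul]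
  convert monic_polyNorm_X_sub_C b 0 using 2
  have hC : (C e : S[X]) * C e = C e := by rw [← C_mul, he.eq]
  simp only [C_sub, C_1, C_0]
  linear_combination (-(X - 1) ^ 2) * hC

lemma monic_cornerCharpoly_mul_rankPoly (x : S) {e : S} (he : IsIdempotentElem e) :
    (cornerCharpoly b x e * rankPoly b (1 - e)).Monic := by
  rw [rankPoly, cornerCharpoly, ← polyNorm_mul]
  convert monic_polyNorm_X_sub_C b (x * e) using 2
  have hC : (C e : S[X]) * C e = C e := by rw [← C_mul, he.eq]
  simp only [C_sub, C_1, C_mul]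
  linear_combination (-(X - 1) ^ 2 + (X - 1) * C x) * hC

lemma cornerCharpoly_mul_cornerCharpoly (x : S) {e : S} (he : IsIdempotentElem e) :
    cornerCharpoly b x (1 - e) * cornerCharpoly b x e =
      (Algebra.leftMulMatrix b x).charpoly := by
  rw [cornerCharpoly, cornerCharpoly, ← polyNorm_mul, ← polyNorm_X_sub_C]
  congr 1
  have hC : (C e : S[X]) * C e = C e := by rw [← C_mul, he.eq]
  simp only [C_sub, C_1, C_mul]
  linear_combination (-(X - 1 - C x) ^ 2) * hC

lemma vecMul_mulMatrix (s : S) : b ᵥ* mulMatrix b S s = s • (b : ι → S) := by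
  ext j
  have := b.sum_repr (s * b j)
  simpa [vecMul, dotProduct, mulMatrix, Algebra.leftMulMatrix_eq_repr_mul, Algebra.smul_def,
    mul_comm] using this

lemma mul_aeval_cornerCharpoly (x : S) {e : S} (he : IsIdempotentElem e) :
    e * aeval x (cornerCharpoly b x e) = 0 := by
  rw [cornerCharpoly, map_polyNorm, aeval_X, polyNorm]
  set M := polyMulMatrix b x (C e * X + C (1 - e - x * e)) with hM
  have h1 : b ᵥ* M = (1 - e) • (b : ι → S) := by
    simp only [hM, map_add, map_mul, polyMulMatrix_C, polyMulMatrix_X,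
      Algebra.algebraMap_eq_smul_one, Algebra.mul_smul_comm, mul_one, vecMul_add, vecMul_smul,
      vecMul_mulMatrix, ← mul_smul, ← add_smul]
    congr 1
    ring
  have h2 : (e * M.det) • (b : ι → S) = 0 := by
    have h3 : b ᵥ* (M * M.adjugate) = M.det • (b : ι → S) := by
      rw [mul_adjugate, vecMul_smul, vecMul_one]
    rw [mul_smul, ← h3, ← vecMul_vecMul, h1, smul_vecMul, ← mul_smul, mul_sub, mul_one, he.eq,
      sub_self, zero_smul]
  have h4 : LinearMap.mulLeft R (e * M.det) = 0 := b.ext fun i => by simpa [mul_assoc] using congrFun h2 i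
  simpa using LinearMap.congr_fun h4 1

lemma mem_range_leftMulMatrix_of_commute {x : S} (hx : Algebra.adjoin R {x} = ⊤)
    {E : Matrix ι ι R} (hE : Commute E (Algebra.leftMulMatrix b x)) :
    ∃ e : S, Algebra.leftMulMatrix b e = E := by
  set φ := Matrix.toLin b b E with hφ
  have hxφ (y : S) : φ (x * y) = x * φ y := by
    have h1 := congrArg (Matrix.toLin b b) hE.eq
    rw [Matrix.toLin_mul b b b, Matrix.toLin_mul b b b] at h1
    have h2 := LinearMap.congr_fun h1 y
    simpa [Algebra.leftMulMatrix_apply, hφ] using h2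
  have hs (s : S) : ∀ y, φ (s * y) = s * φ y := by
    have hmem : s ∈ Algebra.adjoin R {x} := hx ▸ Algebra.mem_top
    induction hmem using Algebra.adjoin_induction with
    | mem s hs => rw [Set.mem_singleton_iff.1 hs]; exact hxφ
    | algebraMap r => intro y; simp [← Algebra.smul_def]
    | add s t _ _ h1 h2 => intro y; simp [add_mul, h1, h2]
    | mul s t _ _ h1 h2 => intro y; rw [mul_assoc, h1, h2, mul_assoc]
  refine ⟨φ 1, ?_⟩
  rw [Algebra.leftMulMatrix_apply, ← LinearMap.toMatrix_toLin b b E, ← hφ]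
  congr 1
  ext y
  simpa [mul_comm] using (hs y 1).symm

lemma isStronglyClean_of_leftMulMatrix {x : S} (hx : Algebra.adjoin R {x} = ⊤)
    (h : IsStronglyClean (Algebra.leftMulMatrix b x)) : IsStronglyClean x := by
  obtain ⟨E, U, hE, hU, hsum, hcomm⟩ := h
  have hinj := Algebra.leftMulMatrix_injective b
  obtain ⟨e, rfl⟩ := mem_range_leftMulMatrix_of_commute b hx (E := E) (by
    rw [hsum]; exact (Commute.refl E).add_right hcomm)
  have hU' : U = Algebra.leftMulMatrix b (x - e) := by rw [map_sub, hsum]; abel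
  refine ⟨e, x - e, hinj (by rw [map_mul, hE.eq]), ?_, by ring, mul_comm _ _⟩
  obtain ⟨V, hV⟩ := hU
  obtain ⟨v, hv⟩ := mem_range_leftMulMatrix_of_commute b hx (E := (V⁻¹ : (Matrix ι ι R)ˣ).1) (by
    apply Commute.units_inv_left
    rw [hV, hsum]
    exact Commute.add_right hcomm.symm (Commute.refl U))
  refine IsUnit.of_mul_eq_one v (hinj ?_)
  rw [map_mul, map_one, ← hU', hv, ← hV, Units.mul_inv]

end AffineDeterminant

section SRCFactorization

open Polynomial

variable {R : Type*} [CommRing R]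

/-- The class of `X` in `R[X] / (h)` is the sum of an idempotent `p` and a unit, with inverse
`q`, expressed in terms of representatives. -/
def IsCleanModulo (h : R[X]) : Prop :=
  ∃ p q r s : R[X], p * p - p = h * r ∧ (X - p) * q - 1 = h * s

lemma HasSRCFactorization.isCleanModulo {h : R[X]} (hh : HasSRCFactorization h) :
    IsCleanModulo h := by
  obtain ⟨f₀, f₁, -, -, rfl, h0, h1, u, v, huv⟩ := hh
  obtain ⟨a, ha⟩ := h0.exists_right_inv
  obtain ⟨b, hb⟩ := h1.exists_right_inv
  obtain ⟨g₀, hg₀⟩ := X_sub_C_dvd_sub_C_eval (a := (0 : R)) (p := f₀)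
  obtain ⟨g₁, hg₁⟩ := X_sub_C_dvd_sub_C_eval (a := (1 : R)) (p := f₁)
  have ha' : C (f₀.eval 0) * C a = 1 := by rw [← C_mul, ha, C_1]
  have hb' : C (f₁.eval 1) * C b = 1 := by rw [← C_mul, hb, C_1]
  rw [C_0, sub_zero] at hg₀
  rw [C_1] at hg₁
  have e0 : X * (-C a * g₀) = 1 - C a * f₀ := by linear_combination C a * hg₀ + ha'
  have e1 : (X - 1) * (-C b * g₁) = 1 - C b * f₁ := by linear_combination C b * hg₁ + hb'
  have hv : f₁ * v = 1 - f₀ * u := by linear_combination huv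
  have hp : f₀ * u * (f₀ * u) - f₀ * u = f₀ * f₁ * (-(u * v)) := by
    linear_combination (f₀ * u) * hv
  refine ⟨f₀ * u, (1 - f₀ * u) * (-C a * g₀) + f₀ * u * (-C b * g₁), -(u * v),
    -(C a * v + C b * u) + u * v * (C a * g₀ - C b * g₁), hp, ?_⟩
  linear_combination (1 - f₀ * u) * e0 + f₀ * u * e1 +
    (C b * g₁ - C a * g₀) * hp + (C a * f₀) * hv

lemma IsCleanModulo.isStronglyClean_of_aeval_eq_zero {S : Type*} [Ring S] [Algebra R S]
    {h : R[X]} (hh : IsCleanModulo h) {a : S} (ha : aeval a h = 0) : IsStronglyClean a := by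
  obtain ⟨p, q, r, s, hp, hq⟩ := hh
  have hp' := congrArg (aeval a) hp
  have hq' := congrArg (aeval a) hq
  rw [mul_comm (X - p)] at hq
  have hq'' := congrArg (aeval a) hq
  simp only [map_mul, map_sub, map_one, aeval_X, ha, zero_mul, sub_eq_zero] at hp' hq' hq''
  refine ⟨aeval a p, a - aeval a p, hp', ⟨⟨_, _, hq', hq''⟩, rfl⟩, by abel, ?_⟩
  have hcomm : aeval a p * a = a * aeval a p := by
    simpa using congrArg (aeval a) (mul_comm p X)
  rw [mul_sub, sub_mul, hcomm]

lemma isCleanModulo_of_isStronglyClean_root {h : R[X]}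
    (hh : IsStronglyClean (AdjoinRoot.root h)) : IsCleanModulo h := by
  obtain ⟨e, u, he, hu, hsum, -⟩ := hh
  obtain ⟨v, hv⟩ := hu.exists_right_inv
  obtain ⟨p, rfl⟩ := AdjoinRoot.mk_surjective e
  obtain ⟨q, rfl⟩ := AdjoinRoot.mk_surjective v
  have h1 : h ∣ p * p - p := by
    rw [← AdjoinRoot.mk_eq_zero, map_sub, map_mul, he.eq, sub_self]
  have h2 : h ∣ (X - p) * q - 1 := by
    rw [← AdjoinRoot.mk_eq_zero, map_sub, map_mul, map_sub, AdjoinRoot.mk_X, hsum,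
      add_sub_cancel_left, hv, map_one, sub_self]
  obtain ⟨r, hr⟩ := h1
  obtain ⟨s, hs⟩ := h2
  exact ⟨p, q, r, s, hr, hs⟩

lemma C_mul_eq_zero_of_map_eq_zero {e : R} (he : IsIdempotentElem e) {q : R[X]}
    (hq : q.map (Ideal.Quotient.mk (Ideal.span {1 - e})) = 0) : C e * q = 0 := by
  ext i
  have h1 := congrArg (coeff · i) hq
  simp only [coeff_map, coeff_zero, Ideal.Quotient.eq_zero_iff_mem,
    Ideal.mem_span_singleton] at h1
  obtain ⟨d, hd⟩ := h1
  rw [coeff_C_mul, hd, coeff_zero]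
  linear_combination -d * he.eq

lemma HasGSRCFactorization.isCleanModulo {h : R[X]} (hh : HasGSRCFactorization h) :
    IsCleanModulo h := by
  obtain ⟨k, e, ⟨hid, horth, hsum⟩, hfact⟩ := hh
  have hloc (i : Fin k) : ∃ p q r s : R[X],
      C (e i) * (p * p - p - h * r) = 0 ∧ C (e i) * ((X - p) * q - 1 - h * s) = 0 := by
    obtain ⟨p, q, r, s, hp, hq⟩ := (hfact i).isCleanModulo
    have hsurj := Polynomial.map_surjective _
      (Ideal.Quotient.mk_surjective (I := Ideal.span {1 - e i}))
    obtain ⟨p, rfl⟩ := hsurj p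
    obtain ⟨q, rfl⟩ := hsurj q
    obtain ⟨r, rfl⟩ := hsurj r
    obtain ⟨s, rfl⟩ := hsurj s
    refine ⟨p, q, r, s, C_mul_eq_zero_of_map_eq_zero (hid i) ?_,
      C_mul_eq_zero_of_map_eq_zero (hid i) ?_⟩
    · simpa [sub_eq_zero] using hp
    · simpa [sub_eq_zero] using hq
  choose p q r s hp hq using hloc
  have hglue (f : Fin k → R[X]) (i : Fin k) : C (e i) * ∑ j, C (e j) * f j = C (e i) * f i := by
    rw [Finset.mul_sum, Finset.sum_eq_single i]
    · rw [← mul_assoc, ← C_mul, (hid i).eq]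
    · intro j _ hji
      rw [← mul_assoc, ← C_mul, horth i j hji.symm, C_0, zero_mul]
    · simp
  have hzero (z : R[X]) (hz : ∀ i, C (e i) * z = 0) : z = 0 := by
    rw [← one_mul z, ← C_1, ← hsum, map_sum, Finset.sum_mul]
    exact Finset.sum_eq_zero fun i _ => hz i
  refine ⟨∑ j, C (e j) * p j, ∑ j, C (e j) * q j, ∑ j, C (e j) * r j, ∑ j, C (e j) * s j,
    sub_eq_zero.1 (hzero _ fun i => ?_), sub_eq_zero.1 (hzero _ fun i => ?_)⟩
  · have hpi := hglue p i
    have hri := hglue r i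
    generalize ∑ j, C (e j) * p j = P at *
    generalize ∑ j, C (e j) * r j = Q at *
    linear_combination hp i + (P + p i - 1) * hpi - h * hri
  · have hpi := hglue p i
    have hqi := hglue q i
    have hsi := hglue s i
    generalize ∑ j, C (e j) * p j = P at *
    generalize ∑ j, C (e j) * q j = Q at *
    generalize ∑ j, C (e j) * s j = T at *
    linear_combination hq i + (X - P) * hqi - q i * hpi - h * hsi

lemma charpoly_leftMulMatrix_root {h : R[X]} (hmonic : h.Monic) :
    (Algebra.leftMulMatrix (AdjoinRoot.powerBasisAux' hmonic) (AdjoinRoot.root h)).charpoly =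
      h := by
  nontriviality R
  have h1 : h ∣ (Algebra.leftMulMatrix (AdjoinRoot.powerBasisAux' hmonic)
      (AdjoinRoot.root h)).charpoly := by
    rw [← AdjoinRoot.mk_eq_zero, ← AdjoinRoot.aeval_eq]
    apply Algebra.leftMulMatrix_injective (AdjoinRoot.powerBasisAux' hmonic)
    rw [← Polynomial.aeval_algHom_apply, Matrix.aeval_self_charpoly, map_zero]
  refine (eq_of_monic_of_dvd_of_natDegree_le hmonic (Matrix.charpoly_monic _) h1 ?_)
  rw [Matrix.charpoly_natDegree_eq_dim, Fintype.card_fin]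

lemma leftMulMatrix_root {h : R[X]} (hmonic : h.Monic) :
    Algebra.leftMulMatrix (AdjoinRoot.powerBasisAux' hmonic) (AdjoinRoot.root h) =
      companionMatrix h.natDegree h := by
  nontriviality R
  have h1 := PowerBasis.leftMulMatrix (AdjoinRoot.powerBasis' hmonic)
  have h2 := charpoly_leftMulMatrix (AdjoinRoot.powerBasis' hmonic)
  have h3 := charpoly_leftMulMatrix_root hmonic
  have h4 : (AdjoinRoot.powerBasis' hmonic).minpolyGen = h := by
    rw [PowerBasis.minpolyGen_eq, ← h2]
    exact h3
  rw [h4] at h1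
  refine h1.trans ?_
  ext i j
  change (if (j : ℕ) + 1 = h.natDegree then -h.coeff i else
    if (i : ℕ) = j + 1 then 1 else 0) = if (i : ℕ) = j + 1 then 1 else
    if (j : ℕ) = h.natDegree - 1 then -h.coeff i else 0
  have hi : (i : ℕ) < h.natDegree := i.2
  split_ifs <;> first | rfl | omega

lemma isCompleteOrthogonalIdempotents_coeff_rankPoly {S : Type*} [CommRing S] [Algebra R S]
    {ι : Type*} [Fintype ι] [DecidableEq ι] (b : Module.Basis ι R S) {e : S}
    (he : IsIdempotentElem e) :
    IsCompleteOrthogonalIdempotents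
      fun i : Fin ((rankPoly b e).natDegree + 1) => (rankPoly b e).coeff i := by
  refine ⟨fun i => ?_, fun i j hij => ?_, ?_⟩
  · simpa [IsIdempotentElem] using rankPoly_coeff_mul_coeff b he i i
  · rw [rankPoly_coeff_mul_coeff b he, if_neg (fun hh => hij (Fin.ext hh))]
  · have h1 := rankPoly_eval_one b e
    rw [eval_eq_sum_range] at h1
    simpa [Finset.sum_range] using h1

lemma map_rankPoly_quotient {S : Type*} [CommRing S] [Algebra R S]
    {ι : Type*} [Fintype ι] [DecidableEq ι] (b : Module.Basis ι R S) {e : S}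
    (he : IsIdempotentElem e) (i : ℕ) :
    (rankPoly b e).map (Ideal.Quotient.mk (Ideal.span {1 - (rankPoly b e).coeff i})) = X ^ i := by
  have h1 : Ideal.Quotient.mk (Ideal.span {1 - (rankPoly b e).coeff i})
      ((rankPoly b e).coeff i) = 1 := by
    rw [← map_one (Ideal.Quotient.mk _), eq_comm, Ideal.Quotient.mk_eq_mk_iff_sub_mem]
    exact Ideal.mem_span_singleton_self _
  ext j
  have h2 := congrArg (Ideal.Quotient.mk (Ideal.span {1 - (rankPoly b e).coeff i}))
    (rankPoly_coeff_mul_coeff b he j i)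
  rw [map_mul, h1, mul_one] at h2
  rw [coeff_map, h2, coeff_X_pow]
  split_ifs
  · exact h1
  · exact map_zero _

lemma hasGSRCFactorization_of_isStronglyClean_root {h : R[X]} (hmonic : h.Monic)
    (hh : IsStronglyClean (AdjoinRoot.root h)) : HasGSRCFactorization h := by
  obtain ⟨e, u, he, hu, hsum, -⟩ := hh
  set x := AdjoinRoot.root h with hx
  set b := AdjoinRoot.powerBasisAux' hmonic with hb
  have hmul : cornerCharpoly b x (1 - e) * cornerCharpoly b x e = h := by
    rw [cornerCharpoly_mul_cornerCharpoly b x he]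
    exact charpoly_leftMulMatrix_root hmonic
  obtain ⟨v, hv⟩ := hu.exists_right_inv
  have hu₀ : IsUnit ((cornerCharpoly b x (1 - e)).eval 0) := by
    apply isUnit_eval_polyNorm
    refine IsUnit.of_mul_eq_one (-v * (1 - e) + e) ?_
    simp only [eval_add, eval_mul, eval_C, eval_X, map_zero]
    rw [hsum]
    linear_combination (1 - e) ^ 2 * hv + (2 + e + u + v * e) * he.eq
  have hu₁ : IsUnit ((cornerCharpoly b x e).eval 1) := by
    apply isUnit_eval_polyNorm
    refine IsUnit.of_mul_eq_one (-v * e + (1 - e)) ?_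
    simp only [eval_add, eval_mul, eval_C, eval_X, map_one]
    rw [hsum]
    linear_combination e ^ 2 * hv + ((e + 1) * (1 + v) + u) * he.eq
  obtain ⟨p, rfl⟩ := AdjoinRoot.mk_surjective e
  set f₁ := cornerCharpoly b x (AdjoinRoot.mk h p) with hf₁
  set f₀ := cornerCharpoly b x (1 - AdjoinRoot.mk h p) with hf₀
  have hdvd₁ : h ∣ p * f₁ := by
    rw [← AdjoinRoot.mk_eq_zero, map_mul, ← AdjoinRoot.aeval_eq f₁]
    exact mul_aeval_cornerCharpoly b x he
  have hdvd₀ : h ∣ (1 - p) * f₀ := by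
    rw [← AdjoinRoot.mk_eq_zero, map_mul, map_sub, map_one, ← AdjoinRoot.aeval_eq f₀]
    exact mul_aeval_cornerCharpoly b x he.one_sub
  obtain ⟨c₁, hc₁⟩ := hdvd₁
  obtain ⟨c₀, hc₀⟩ := hdvd₀
  refine ⟨_, _, isCompleteOrthogonalIdempotents_coeff_rankPoly b he, fun i => ?_⟩
  have hρ := map_rankPoly_quotient b he i
  set π := Ideal.Quotient.mk (Ideal.span {1 - (rankPoly b (AdjoinRoot.mk h p)).coeff i})
  have hm₁ : ((rankPoly b (AdjoinRoot.mk h p)).map π).Monic := hρ ▸ monic_X_pow _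
  have hm₀ : ((rankPoly b (1 - AdjoinRoot.mk h p)).map π).Monic := by
    refine hm₁.of_mul_monic_right ?_
    rw [← Polynomial.map_mul]
    exact (monic_rankPoly_mul_rankPoly b he).map π
  have hmf₁ : (f₁.map π).Monic := by
    refine hm₀.of_mul_monic_right ?_
    rw [← Polynomial.map_mul]
    exact (monic_cornerCharpoly_mul_rankPoly b x he).map π
  have hmf₀ : (f₀.map π).Monic := by
    refine hm₁.of_mul_monic_right ?_
    rw [← Polynomial.map_mul]
    simpa only [sub_sub_cancel] using (monic_cornerCharpoly_mul_rankPoly b x he.one_sub).map π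
  refine ⟨f₀.map π, f₁.map π, hmf₀, hmf₁, ?_, ?_, ?_, c₁.map π, c₀.map π, ?_⟩
  · rw [← Polynomial.map_mul, hmul]
  · simpa using hu₀.map π
  · simpa using hu₁.map π
  · rw [← hmul] at hc₀ hc₁
    have hc₁' := congrArg (Polynomial.map π) hc₁
    have hc₀' := congrArg (Polynomial.map π) hc₀
    simp only [Polynomial.map_mul, Polynomial.map_sub, Polynomial.map_one] at hc₀' hc₁'
    have h1 : p.map π = f₀.map π * c₁.map π :=
      hmf₁.isRegular.right (by linear_combination hc₁')
    have h2 : 1 - p.map π = f₁.map π * c₀.map π :=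
      hmf₀.isRegular.right (by linear_combination hc₀')
    rw [← h1, ← h2, add_sub_cancel]

end SRCFactorization

/-- Over a commutative clean ring, for a monic `h` of degree `n ≥ 2`, the following are
equivalent: every matrix with characteristic polynomial `h` is strongly clean; the companion
matrix of `h` is strongly clean; `h` has a gSRC-factorization. -/
theorem stronglyClean_tfae_of_cleanRing {R : Type*} [CommRing R] (hR : IsCleanRing R)
    {n : ℕ} (hn : 2 ≤ n) (h : Polynomial R) (hmonic : h.Monic) (hdeg : h.natDegree = n) :
    List.TFAE
      [∀ A : Matrix (Fin n) (Fin n) R, A.charpoly = h → IsStronglyClean A,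
       IsStronglyClean (companionMatrix n h),
       HasGSRCFactorization h] := by
  subst hdeg
  have hadjoin : Algebra.adjoin R {AdjoinRoot.root h} = ⊤ := AdjoinRoot.adjoinRoot_eq_top
  tfae_have 1 → 2 := fun H => H _ (by
    rw [← leftMulMatrix_root hmonic]
    exact charpoly_leftMulMatrix_root hmonic)
  tfae_have 2 → 3 := fun H => by
    rw [← leftMulMatrix_root hmonic] at H
    exact hasGSRCFactorization_of_isStronglyClean_root hmonic
      (isStronglyClean_of_leftMulMatrix _ hadjoin H)
  tfae_have 3 → 1 := fun H A hA =>
    H.isCleanModulo.isStronglyClean_of_aeval_eq_zero (by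
      rw [← Matrix.aeval_self_charpoly A, hA])
  tfae_finish
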